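/- Let a, b > 0 satisfy the nine inequalities 2a + b ≥ 1, 3a + 4b ≥ 2, 9a + 11b ≥ 6, a + 5b ≥ 1, 4a + 9b ≥ 3, 10a + 16b ≥ 7, 13a + 20b ≥ 8, 5a + 14b ≥ 4, a + (3/2)b ≥ 2/3. Let G be a graph with no triangle adjacent to a 4-cycle such that α(G) < |V(G)| − (a|V(G)| + b|E(G)| + bλ(G)), and suppose every graph G' with fewer vertices than G and no triangle adjacent to a 4-cycle satisfies α(G') ≥ |V(G')| − (a|V(G')| + b|E(G')| + bλ(G')). Then the maximum degree of G is at most three (and hence, combined with the minimum-degree bound, G is 3-regular). -/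

import Mathlib

namespace Paper

/-- `s` is an independent set in the simple graph `G`. -/
def IsIndepSet {V : Type} (G : SimpleGraph V) (s : Finset V) : Prop :=
  ∀ v ∈ s, ∀ w ∈ s, ¬ G.Adj v w

/-- The independence number `α(G)`: the size of a largest independent set. -/
noncomputable def indepNum {V : Type} (G : SimpleGraph V) : ℕ :=
  sSup {n | ∃ s : Finset V, IsIndepSet G s ∧ s.card = n}

/-- The number of edges `|E(G)|`. -/
noncomputable def numEdges {V : Type} (G : SimpleGraph V) : ℕ :=
  Nat.card G.edgeSet

/-- The degree of a vertex. -/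
noncomputable def deg {V : Type} (G : SimpleGraph V) (v : V) : ℕ :=
  Nat.card (G.neighborSet v)

/-- `G` contains a triangle sharing a common edge with a 4-cycle:
the triangle `u v w` and the 4-cycle `u v x y` share the edge `u v`. -/
def HasTriangleAdjC4 {V : Type} (G : SimpleGraph V) : Prop :=
  ∃ u v w x y : V, G.Adj u v ∧ G.Adj v w ∧ G.Adj w u ∧
    G.Adj v x ∧ G.Adj x y ∧ G.Adj y u ∧ u ≠ x ∧ v ≠ y

/-- `G` contains two triangles sharing a common edge:
the triangles `u v w` and `u v x` share the edge `u v`. -/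
def HasAdjTriangles {V : Type} (G : SimpleGraph V) : Prop :=
  ∃ u v w x : V, G.Adj u v ∧ G.Adj v w ∧ G.Adj w u ∧
    G.Adj v x ∧ G.Adj x u ∧ w ≠ x

/-- `G` contains a triangle sharing a common edge with a 5-cycle:
the triangle `u v w` and the 5-cycle `u v x y z` share the edge `u v`. -/
def HasTriangleAdjC5 {V : Type} (G : SimpleGraph V) : Prop :=
  ∃ u v w x y z : V, G.Adj u v ∧ G.Adj v w ∧ G.Adj w u ∧
    G.Adj v x ∧ G.Adj x y ∧ G.Adj y z ∧ G.Adj z u ∧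
    u ≠ x ∧ u ≠ y ∧ v ≠ y ∧ v ≠ z ∧ x ≠ z

/-- The 2-chain of triangles: two disjoint triangles `{0,1,2}` and `{3,4,5}`
joined by the single edge `{2,3}` (6 vertices, 7 edges). -/
def chainGraph : SimpleGraph (Fin 6) :=
  SimpleGraph.fromRel (fun i j =>
    (i.val, j.val) ∈ [(0,1), (0,2), (1,2), (3,4), (3,5), (4,5), (2,3)])

/-- A connected component is difficult if it is a triangle or a 2-chain of triangles. -/
def IsDifficult {V : Type} (G : SimpleGraph V) (c : G.ConnectedComponent) : Prop :=
  Nonempty (SimpleGraph.induce c.supp G ≃g (⊤ : SimpleGraph (Fin 3))) ∨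
  Nonempty (SimpleGraph.induce c.supp G ≃g chainGraph)

/-- `λ(G)`: the number of difficult components of `G`. -/
noncomputable def lambda {V : Type} (G : SimpleGraph V) : ℕ :=
  Nat.card {c : G.ConnectedComponent // IsDifficult G c}

/-- `Φ(S)`: the number of edges of `G` with exactly one endpoint in `S`. -/
noncomputable def phi {V : Type} (G : SimpleGraph V) (S : Set V) : ℕ :=
  Nat.card {e : Sym2 V | e ∈ G.edgeSet ∧ ∃ x ∈ S, ∃ y, y ∉ S ∧ e = s(x, y)}

section Counting

set_option linter.unusedSectionVars false

variable {V : Type} [Fintype V] [DecidableEq V] (G : SimpleGraph V) [DecidableRel G.Adj]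

/-- The number of neighbours of `x` in `A`. -/
def nbrCount (A : Finset V) (x : V) : ℕ := ∑ y ∈ A, if G.Adj x y then 1 else 0

/-- The number of pairs `(x, y)` with `x ∈ B`, `y ∈ A` and `x` adjacent to `y`. -/
def cut (A B : Finset V) : ℕ := ∑ x ∈ B, nbrCount G A x

/-- `K` is the vertex set of a triangle. -/
def IsTriangleSet (K : Finset V) : Prop :=
  ∃ x y z, G.Adj x y ∧ G.Adj y z ∧ G.Adj x z ∧ K = {x, y, z}

/-- `K` induces a 2-chain of triangles. -/
def IsChainSet (K : Finset V) : Prop :=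
  ∃ x y z p q r, G.Adj x y ∧ G.Adj y z ∧ G.Adj x z ∧ G.Adj p q ∧ G.Adj q r ∧ G.Adj p r ∧
    G.Adj z p ∧ ¬ G.Adj x p ∧ ¬ G.Adj x q ∧ ¬ G.Adj x r ∧ ¬ G.Adj y p ∧ ¬ G.Adj y q ∧
    ¬ G.Adj y r ∧ ¬ G.Adj z q ∧ ¬ G.Adj z r ∧ K = {x, y, z, p, q, r}

/-- `K` is the vertex set of a difficult component of `G - S`. -/
def IsDifficultSet (S K : Finset V) : Prop :=
  (IsTriangleSet G K ∨ IsChainSet G K) ∧ Disjoint S K ∧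
    ∀ x ∈ K, ∀ y, G.Adj x y → y ∈ K ∨ y ∈ S

/-- The vertex sets of the difficult components of `G - S`. -/
noncomputable def difficultSets (S : Finset V) : Finset (Finset V) :=
  (Set.toFinite {K | IsDifficultSet G S K}).toFinset

/-- The difficult components of `G - S` joined to `S` by an edge. -/
noncomputable def touchingSets (S : Finset V) : Finset (Finset V) :=
  {K ∈ difficultSets G S | 1 ≤ cut G S K}

variable {G}

@[simp] lemma mem_difficultSets {S K : Finset V} :
    K ∈ difficultSets G S ↔ IsDifficultSet G S K := by
  simp [difficultSets]

lemma mem_touchingSets {S K : Finset V} :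
    K ∈ touchingSets G S ↔ IsDifficultSet G S K ∧ 1 ≤ cut G S K := by
  simp [touchingSets]

lemma nbrCount_univ (x : V) : nbrCount G Finset.univ x = deg G x := by
  rw [nbrCount, deg, Nat.card_eq_fintype_card, SimpleGraph.card_neighborSet_eq_degree,
    ← SimpleGraph.card_neighborFinset_eq_degree, Finset.sum_boole,
    SimpleGraph.neighborFinset_eq_filter]
  simp

lemma nbrCount_mono {A B : Finset V} (h : A ⊆ B) (x : V) : nbrCount G A x ≤ nbrCount G B x :=
  Finset.sum_le_sum_of_subset h

lemma nbrCount_le_deg (A : Finset V) (x : V) : nbrCount G A x ≤ deg G x :=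
  nbrCount_univ (G := G) x ▸ nbrCount_mono (Finset.subset_univ A) x

lemma nbrCount_union {A B : Finset V} (h : Disjoint A B) (x : V) :
    nbrCount G (A ∪ B) x = nbrCount G A x + nbrCount G B x :=
  Finset.sum_union h

lemma nbrCount_of_forall {A : Finset V} {x : V} (h : ∀ y, G.Adj x y → y ∈ A) :
    nbrCount G A x = deg G x := by
  rw [← nbrCount_univ]
  apply Finset.sum_subset (Finset.subset_univ A)
  intro y _ hy
  simp only [ite_eq_right_iff, one_ne_zero, imp_false]
  exact fun hxy => hy (h y hxy)

lemma nbrCount_pos {A : Finset V} {x : V} : 1 ≤ nbrCount G A x ↔ ∃ y ∈ A, G.Adj x y := by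
  rw [nbrCount, Finset.sum_boole, Nat.cast_id, Nat.succ_le_iff, Finset.card_pos]
  simp [Finset.Nonempty]

lemma nbrCount_singleton (y x : V) : nbrCount G {y} x = if G.Adj x y then 1 else 0 := by
  simp [nbrCount, -Finset.sum_boole]

lemma nbrCount_insert {A : Finset V} {y : V} (h : y ∉ A) (x : V) :
    nbrCount G (insert y A) x = (if G.Adj x y then 1 else 0) + nbrCount G A x := by
  simp [nbrCount, Finset.sum_insert h]

lemma cut_singleton (A : Finset V) (x : V) : cut G A {x} = nbrCount G A x := by
  simp [cut]

lemma cut_insert (A : Finset V) {B : Finset V} {x : V} (h : x ∉ B) :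
    cut G A (insert x B) = nbrCount G A x + cut G A B := by
  simp [cut, Finset.sum_insert h]

lemma cut_comm (A B : Finset V) : cut G A B = cut G B A := by
  unfold cut nbrCount
  rw [Finset.sum_comm]
  simp only [G.adj_comm]

lemma cut_union_left {A B : Finset V} (h : Disjoint A B) (C : Finset V) :
    cut G (A ∪ B) C = cut G A C + cut G B C := by
  simp [cut, nbrCount_union h, Finset.sum_add_distrib]

lemma cut_union_right (C : Finset V) {A B : Finset V} (h : Disjoint A B) :
    cut G C (A ∪ B) = cut G C A + cut G C B :=
  Finset.sum_union h

lemma cut_pos {A B : Finset V} : 1 ≤ cut G A B ↔ ∃ x ∈ B, ∃ y ∈ A, G.Adj x y := by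
  simp only [← nbrCount_pos]
  rw [cut, Nat.succ_le_iff, Finset.sum_pos_iff]
  rfl

lemma cut_univ_split (S : Finset V) :
    cut G Finset.univ S = cut G S S + cut G S Sᶜ := by
  rw [cut_comm S Sᶜ, ← cut_union_left disjoint_compl_right, Finset.union_compl]

lemma IsDifficultSet.disjoint {S K : Finset V} (h : IsDifficultSet G S K) : Disjoint S K := h.2.1

lemma IsDifficultSet.deg_eq {S K : Finset V} (h : IsDifficultSet G S K) {x : V} (hx : x ∈ K) :
    deg G x = nbrCount G K x + nbrCount G S x := by
  rw [← nbrCount_union h.2.1.symm]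
  exact (nbrCount_of_forall fun y hy => by simpa using h.2.2 x hx y hy).symm

lemma IsDifficultSet.cut_univ {S K : Finset V} (h : IsDifficultSet G S K) :
    cut G Finset.univ K = cut G K K + cut G S K := by
  simp only [cut, ← Finset.sum_add_distrib]
  exact Finset.sum_congr rfl fun x hx => by rw [nbrCount_univ, h.deg_eq hx]

lemma card_triangle {x y z : V} (hxy : G.Adj x y) (hyz : G.Adj y z) (hxz : G.Adj x z) :
    ({x, y, z} : Finset V).card = 3 :=
  Finset.card_eq_three.2 ⟨x, y, z, hxy.ne, hxz.ne, hyz.ne, rfl⟩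

lemma IsTriangleSet.card_eq {K : Finset V} (h : IsTriangleSet G K) : K.card = 3 := by
  obtain ⟨x, y, z, hxy, hyz, hxz, rfl⟩ := h
  exact card_triangle hxy hyz hxz

lemma IsTriangleSet.cut_self {K : Finset V} (h : IsTriangleSet G K) : cut G K K = 6 := by
  obtain ⟨x, y, z, hxy, hyz, hxz, rfl⟩ := h
  simp [cut, nbrCount, hxy, hyz, hxz, hxy.symm, hyz.symm, hxz.symm, hxy.ne, hyz.ne, hxz.ne,
    -Finset.sum_boole]

lemma chain_ne {x y z p q r : V} (h1 : G.Adj x y) (h2 : G.Adj y z) (h3 : G.Adj x z)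
    (h4 : G.Adj p q) (h5 : G.Adj q r) (h6 : G.Adj p r) (h7 : G.Adj z p) (h8 : ¬ G.Adj x p)
    (h9 : ¬ G.Adj x q) (h10 : ¬ G.Adj x r) (h11 : ¬ G.Adj y p) (h12 : ¬ G.Adj y q)
    (h13 : ¬ G.Adj y r) :
    x ≠ y ∧ x ≠ z ∧ x ≠ p ∧ x ≠ q ∧ x ≠ r ∧ y ≠ z ∧ y ≠ p ∧ y ≠ q ∧ y ≠ r ∧
      z ≠ p ∧ z ≠ q ∧ z ≠ r ∧ p ≠ q ∧ p ≠ r ∧ q ≠ r := by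
  have := G.adj_comm
  have := G.loopless
  grind [SimpleGraph.Adj.ne]

lemma IsChainSet.card_eq {K : Finset V} (h : IsChainSet G K) : K.card = 6 := by
  obtain ⟨x, y, z, p, q, r, h1, h2, h3, h4, h5, h6, h7, h8, h9, h10, h11, h12, h13, -, -,
    rfl⟩ := h
  simp [chain_ne h1 h2 h3 h4 h5 h6 h7 h8 h9 h10 h11 h12 h13]

lemma IsChainSet.cut_self {K : Finset V} (h : IsChainSet G K) : cut G K K = 14 := by
  obtain ⟨x, y, z, p, q, r, h1, h2, h3, h4, h5, h6, h7, h8, h9, h10, h11, h12, h13, h14, h15,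
    rfl⟩ := h
  have hne := chain_ne h1 h2 h3 h4 h5 h6 h7 h8 h9 h10 h11 h12 h13
  have hs : ∀ s t, ¬ G.Adj s t → ¬ G.Adj t s := fun s t hst hts => hst hts.symm
  simp [cut, nbrCount, hne, h1, h2, h3, h4, h5, h6, h7, h8, h9, h10, h11, h12, h13, h14, h15,
    h1.symm, h2.symm, h3.symm, h4.symm, h5.symm, h6.symm, h7.symm, hs _ _ h8, hs _ _ h9,
    hs _ _ h10, hs _ _ h11, hs _ _ h12, hs _ _ h13, hs _ _ h14, hs _ _ h15, -Finset.sum_boole]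

/-- A set meeting `K` and closed under adjacency inside `K` contains `K`. -/
lemma IsDifficultSet.subset_of_closed {S K : Finset V} (h : IsDifficultSet G S K) {C : Set V}
    {x : V} (hx : x ∈ K) (hxC : x ∈ C) (hC : ∀ p ∈ K, ∀ q ∈ K, G.Adj p q → p ∈ C → q ∈ C) :
    ↑K ⊆ C := by
  have hC' : ∀ p ∈ K, ∀ q ∈ K, G.Adj p q → (p ∈ C ↔ q ∈ C) := fun p hp q hq hpq =>
    ⟨hC p hp q hq hpq, hC q hq p hp hpq.symm⟩
  rcases h.1 with ⟨x', y, z, h1, h2, h3, rfl⟩ |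
    ⟨x', y, z, p, q, r, h1, h2, h3, h4, h5, h6, h7, -, -, -, -, -, -, -, -, rfl⟩
  · have e1 := hC' x' (by simp) y (by simp) h1
    have e2 := hC' y (by simp) z (by simp) h2
    simp only [Finset.mem_insert, Finset.mem_singleton] at hx
    simp only [Finset.coe_insert, Finset.coe_singleton, Set.insert_subset_iff,
      Set.singleton_subset_iff]
    rcases hx with rfl | rfl | rfl <;> tauto
  · have e1 := hC' x' (by simp) y (by simp) h1
    have e2 := hC' y (by simp) z (by simp) h2
    have e3 := hC' z (by simp) p (by simp) h7
    have e4 := hC' p (by simp) q (by simp) h4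
    have e5 := hC' q (by simp) r (by simp) h5
    simp only [Finset.mem_insert, Finset.mem_singleton] at hx
    simp only [Finset.coe_insert, Finset.coe_singleton, Set.insert_subset_iff,
      Set.singleton_subset_iff]
    have : x' ∈ C := by
      rcases hx with rfl | rfl | rfl | rfl | rfl | rfl
      · exact hxC
      all_goals simp_all only
    simp_all only [and_self, true_iff, iff_true]

lemma IsDifficultSet.eq_of_mem {S K L : Finset V} (hK : IsDifficultSet G S K)
    (hL : IsDifficultSet G S L) {x : V} (hxK : x ∈ K) (hxL : x ∈ L) : K = L := by
  apply Finset.Subset.antisymm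
  · have := hK.subset_of_closed (C := ↑L) hxK hxL fun p hp q hq hpq hpL => by
      rcases hL.2.2 p hpL q hpq with h | h
      · exact h
      · exact absurd hq (Finset.disjoint_left.1 hK.2.1 h)
    exact_mod_cast this
  · have := hL.subset_of_closed (C := ↑K) hxL hxK fun p hp q hq hpq hpL => by
      rcases hK.2.2 p hpL q hpq with h | h
      · exact h
      · exact absurd hq (Finset.disjoint_left.1 hL.2.1 h)
    exact_mod_cast this

lemma IsDifficultSet.disjoint_of_ne {S K L : Finset V} (hK : IsDifficultSet G S K)
    (hL : IsDifficultSet G S L) (hne : K ≠ L) : Disjoint K L :=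
  Finset.disjoint_left.2 fun _ hxK hxL => hne (hK.eq_of_mem hL hxK hxL)

lemma IsDifficultSet.union_left {S K L : Finset V} (hK : IsDifficultSet G S K)
    (hL : IsDifficultSet G S L) (hne : K ≠ L) : IsDifficultSet G (S ∪ K) L :=
  ⟨hL.1, Finset.disjoint_union_left.2 ⟨hL.2.1, hK.disjoint_of_ne hL hne⟩, fun x hx y hy => by
    have := hL.2.2 x hx y hy
    rw [Finset.mem_union]
    tauto⟩

lemma IsDifficultSet.not_adj {S K L : Finset V} (hK : IsDifficultSet G S K)
    (hL : IsDifficultSet G S L) (hne : K ≠ L) {x y : V} (hx : x ∈ K) (hy : y ∈ L) :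
    ¬ G.Adj x y := fun hxy => by
  rcases hK.2.2 x hx y hxy with h | h
  · exact Finset.disjoint_left.1 (hK.disjoint_of_ne hL hne) h hy
  · exact Finset.disjoint_left.1 hL.2.1 h hy

lemma IsDifficultSet.cut_eq_zero {S K L : Finset V} (hK : IsDifficultSet G S K)
    (hL : IsDifficultSet G S L) (hne : K ≠ L) : cut G K L = 0 := by
  by_contra h
  obtain ⟨x, hx, y, hy, hxy⟩ := cut_pos.1 (Nat.one_le_iff_ne_zero.2 h)
  exact hL.not_adj hK hne.symm hx hy hxy

lemma sum_touchingSets_add_le (S : Finset V) :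
    ∑ K ∈ touchingSets G S, cut G S K + cut G S S ≤ cut G Finset.univ S := by
  rw [cut_univ_split, add_comm]
  have hd : (touchingSets G S : Set (Finset V)).PairwiseDisjoint id := fun K hK L hL hne =>
    (mem_touchingSets.1 hK).1.disjoint_of_ne (mem_touchingSets.1 hL).1 hne
  have : ∑ K ∈ touchingSets G S, cut G S K
      = cut G S ((touchingSets G S).biUnion id) := (Finset.sum_biUnion hd).symm
  rw [this]
  apply Nat.add_le_add_left
  apply Finset.sum_le_sum_of_subset
  intro x hx
  obtain ⟨K, hK, hxK⟩ := Finset.mem_biUnion.1 hx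
  exact Finset.mem_compl.2 (Finset.disjoint_right.1 (mem_touchingSets.1 hK).1.2.1 hxK)

lemma mul_card_touchingSets_add_le {S : Finset V} {m : ℕ}
    (h : ∀ K ∈ touchingSets G S, m ≤ cut G S K) :
    m * (touchingSets G S).card + cut G S S ≤ cut G Finset.univ S := by
  refine le_trans (Nat.add_le_add_right ?_ _) (sum_touchingSets_add_le S)
  rw [mul_comm, ← smul_eq_mul]
  exact Finset.card_nsmul_le_sum _ _ _ h

lemma card_difficultSets_le (S : Finset V) :
    (difficultSets G S).card ≤ (difficultSets G ∅).card + (touchingSets G S).card := by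
  refine le_trans (Finset.card_le_card ?_) (Finset.card_union_le _ _)
  intro K hK
  rw [Finset.mem_union, mem_difficultSets, mem_touchingSets]
  rw [mem_difficultSets] at hK
  by_cases h : 1 ≤ cut G S K
  · exact Or.inr ⟨hK, h⟩
  · refine Or.inl ⟨hK.1, by simp, fun x hx y hxy => Or.inl ?_⟩
    rcases hK.2.2 x hx y hxy with h' | h'
    · exact h'
    · exact absurd (cut_pos.2 ⟨x, hx, y, h', hxy⟩) h

lemma IsDifficultSet.card_lt {K : Finset V} (hK : IsDifficultSet G ∅ K) :
    (difficultSets G K).card < (difficultSets G ∅).card := by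
  apply Finset.card_lt_card
  rw [Finset.ssubset_iff]
  refine ⟨K, ?_, ?_⟩
  · rw [mem_difficultSets]
    intro h
    have := h.2.1
    rw [disjoint_self, Finset.bot_eq_empty] at this
    rcases hK.1 with h | h <;> have := h.card_eq <;> simp_all
  · intro L hL
    rw [Finset.mem_insert, mem_difficultSets] at hL
    rw [mem_difficultSets]
    rcases hL with rfl | hL
    · exact hK
    · refine ⟨hL.1, by simp, fun x hx y hxy => Or.inl ?_⟩
      rcases hL.2.2 x hx y hxy with h | h
      · exact h
      · have := hK.2.2 y h x hxy.symm
        simp only [Finset.notMem_empty, or_false] at this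
        exact absurd hx (Finset.disjoint_left.1 hL.2.1 this)

end Counting

section MinimalCounterexample

set_option linter.unusedSectionVars false

variable {V : Type} [Fintype V] [DecidableEq V] {G : SimpleGraph V} [DecidableRel G.Adj]

lemma two_mul_numEdges (G : SimpleGraph V) [DecidableRel G.Adj] :
    2 * numEdges G = ∑ x, ∑ y, if G.Adj x y then 1 else 0 := by
  have h : numEdges G = G.edgeFinset.card := by
    rw [numEdges, Nat.card_eq_fintype_card, SimpleGraph.edgeFinset_card]
  rw [h, ← SimpleGraph.sum_degrees_eq_twice_card_edges]
  refine Finset.sum_congr rfl fun x _ => ?_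
  rw [← SimpleGraph.card_neighborFinset_eq_degree, SimpleGraph.neighborFinset_eq_filter,
    Finset.sum_boole, Nat.cast_id]

/-- The subgraph `G - S`. -/
abbrev deleteSet (G : SimpleGraph V) (S : Finset V) : SimpleGraph {x // x ∉ S} :=
  G.comap Subtype.val

lemma two_mul_numEdges_deleteSet (S : Finset V) :
    2 * numEdges (deleteSet G S) = cut G Sᶜ Sᶜ := by
  have hS : ∀ x, x ∈ Sᶜ ↔ x ∉ S := by simp
  rw [two_mul_numEdges, cut, Finset.sum_subtype Sᶜ hS]
  refine Finset.sum_congr rfl fun x _ => ?_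
  rw [nbrCount, Finset.sum_subtype Sᶜ hS]
  rfl

lemma two_mul_numEdges_eq (S : Finset V) :
    2 * numEdges G + cut G S S = 2 * numEdges (deleteSet G S) + 2 * cut G Finset.univ S := by
  have h : 2 * numEdges G = cut G Finset.univ Finset.univ := by
    rw [two_mul_numEdges]; rfl
  have h₁ : cut G Finset.univ Finset.univ = cut G Finset.univ S + cut G Finset.univ Sᶜ := by
    rw [← cut_union_right _ disjoint_compl_right, Finset.union_compl]
  have h₂ : cut G Finset.univ Sᶜ = cut G S Sᶜ + cut G Sᶜ Sᶜ := by
    rw [← cut_union_left disjoint_compl_right, Finset.union_compl]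
  have h₃ := cut_univ_split (G := G) S
  rw [h, two_mul_numEdges_deleteSet]
  omega

lemma IsIndepSet.card_le_indepNum {s : Finset V} (h : IsIndepSet G s) : s.card ≤ indepNum G :=
  le_csSup ⟨Fintype.card V, by rintro n ⟨t, -, rfl⟩; exact t.card_le_univ⟩ ⟨s, h, rfl⟩

lemma exists_isIndepSet_card_eq (G : SimpleGraph V) :
    ∃ s, IsIndepSet G s ∧ s.card = indepNum G :=
  Nat.sSup_mem (s := {n | ∃ s : Finset V, IsIndepSet G s ∧ s.card = n})
    ⟨0, ∅, by simp [IsIndepSet], rfl⟩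
    ⟨Fintype.card V, by rintro n ⟨t, -, rfl⟩; exact t.card_le_univ⟩

lemma card_add_indepNum_deleteSet_le {S I : Finset V} (hI : IsIndepSet G I) (hIS : I ⊆ S)
    (hcl : ∀ x ∈ I, ∀ y, G.Adj x y → y ∈ S) :
    I.card + indepNum (deleteSet G S) ≤ indepNum G := by
  obtain ⟨J, hJ, hJc⟩ := exists_isIndepSet_card_eq (deleteSet G S)
  have hd : Disjoint I (J.map (Function.Embedding.subtype _)) := by
    rw [Finset.disjoint_left]
    intro x hx hx'
    obtain ⟨y, -, rfl⟩ := Finset.mem_map.1 hx'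
    exact y.2 (hIS hx)
  rw [← hJc, ← Finset.card_map (Function.Embedding.subtype _), ← Finset.card_union_of_disjoint hd]
  apply IsIndepSet.card_le_indepNum
  intro x hx y hy hxy
  rw [Finset.mem_union, Finset.mem_map] at hx hy
  rcases hx with hx | ⟨x, hx, rfl⟩ <;> rcases hy with hy | ⟨y, hy, rfl⟩
  · exact hI x hx y hy hxy
  · exact y.2 (hcl _ hx _ hxy)
  · exact x.2 (hcl _ hy _ hxy.symm)
  · exact hJ x hx y hy hxy

lemma isTriangleSet_iff {K : Finset V} :
    IsTriangleSet G K ↔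
      ∃ f : (⊤ : SimpleGraph (Fin 3)) ↪g G, (K : Set V) = Set.range f := by
  constructor
  · rintro ⟨x, y, z, hxy, hyz, hxz, rfl⟩
    have hinj : Function.Injective ![x, y, z] := by
      have := hxy.ne; have := hyz.ne; have := hxz.ne
      intro i j
      fin_cases i <;> fin_cases j <;> simp_all [eq_comm]
    have hadj : ∀ i j, G.Adj (![x, y, z] i) (![x, y, z] j) ↔ (⊤ : SimpleGraph (Fin 3)).Adj i j := by
      intro i j
      fin_cases i <;> fin_cases j <;> simp [hxy, hyz, hxz, hxy.symm, hyz.symm, hxz.symm]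
    refine ⟨⟨⟨![x, y, z], hinj⟩, hadj _ _⟩, ?_⟩
    ext t
    change t ∈ (({x, y, z} : Finset V) : Set V) ↔ t ∈ Set.range ![x, y, z]
    simp [Matrix.range_cons]
    tauto
  · rintro ⟨f, hf⟩
    refine ⟨f 0, f 1, f 2, ?_, ?_, ?_, ?_⟩
    any_goals rw [f.map_adj_iff]; decide
    rw [← Finset.coe_inj, hf]
    ext t
    simp [Fin.exists_fin_succ, eq_comm]

instance : DecidableRel chainGraph.Adj := fun i j => by
  unfold chainGraph
  rw [SimpleGraph.fromRel_adj]
  infer_instance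

lemma isChainSet_iff {K : Finset V} :
    IsChainSet G K ↔ ∃ f : chainGraph ↪g G, (K : Set V) = Set.range f := by
  constructor
  · rintro ⟨x, y, z, p, q, r, h1, h2, h3, h4, h5, h6, h7, h8, h9, h10, h11, h12, h13, h14, h15,
      rfl⟩
    have hne := chain_ne h1 h2 h3 h4 h5 h6 h7 h8 h9 h10 h11 h12 h13
    have hs : ∀ s t, ¬ G.Adj s t → ¬ G.Adj t s := fun s t hst hts => hst hts.symm
    have hinj : Function.Injective ![x, y, z, p, q, r] := by
      intro i j
      fin_cases i <;> fin_cases j <;> simp [hne, Ne.symm, eq_comm]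
    have hadj : ∀ i j, G.Adj (![x, y, z, p, q, r] i) (![x, y, z, p, q, r] j) ↔
        chainGraph.Adj i j := by
      intro i j
      fin_cases i <;> fin_cases j <;>
        simp [chainGraph, h1, h2, h3, h4, h5, h6, h7, h8, h9, h10, h11, h12, h13, h14, h15,
          h1.symm, h2.symm, h3.symm, h4.symm, h5.symm, h6.symm, h7.symm, hs _ _ h8, hs _ _ h9,
          hs _ _ h10, hs _ _ h11, hs _ _ h12, hs _ _ h13, hs _ _ h14, hs _ _ h15]
    refine ⟨⟨⟨![x, y, z, p, q, r], hinj⟩, hadj _ _⟩, ?_⟩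
    ext t
    change t ∈ (({x, y, z, p, q, r} : Finset V) : Set V) ↔ t ∈ Set.range ![x, y, z, p, q, r]
    simp [Matrix.range_cons]
    tauto
  · rintro ⟨f, hf⟩
    refine ⟨f 0, f 1, f 2, f 3, f 4, f 5, ?_, ?_, ?_, ?_, ?_, ?_, ?_, ?_, ?_, ?_, ?_, ?_, ?_,
      ?_, ?_, ?_⟩
    any_goals rw [f.map_adj_iff]; decide
    rw [← Finset.coe_inj, hf]
    ext t
    simp [Fin.exists_fin_succ, eq_comm]

lemma nonempty_induce_iso_iff {W : Type} {H : SimpleGraph W} {s : Set V} :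
    Nonempty (SimpleGraph.induce s G ≃g H) ↔ ∃ f : H ↪g G, s = Set.range f := by
  constructor
  · rintro ⟨e⟩
    refine ⟨(SimpleGraph.Embedding.induce s).comp e.symm.toEmbedding, ?_⟩
    ext t
    constructor
    · intro ht
      exact ⟨e ⟨t, ht⟩, by simp⟩
    · rintro ⟨w, rfl⟩
      exact (e.symm w).2
  · rintro ⟨f, rfl⟩
    exact ⟨f.isoInduceRange.symm⟩

lemma isDifficult_iff {c : G.ConnectedComponent} {K : Finset V} (h : (K : Set V) = c.supp) :
    IsDifficult G c ↔ IsTriangleSet G K ∨ IsChainSet G K := by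
  rw [IsDifficult, isTriangleSet_iff, isChainSet_iff, nonempty_induce_iso_iff,
    nonempty_induce_iso_iff, h]

lemma IsDifficultSet.exists_component {K : Finset V} (hK : IsDifficultSet G ∅ K) :
    ∃ c : G.ConnectedComponent, (K : Set V) = c.supp := by
  have hne : K.Nonempty := by
    rw [Finset.nonempty_iff_ne_empty]
    rintro rfl
    rcases hK.1 with h | h <;> simpa using h.card_eq
  obtain ⟨x, hx⟩ := hne
  refine ⟨G.connectedComponentMk x, Set.Subset.antisymm ?_ ?_⟩
  · exact hK.subset_of_closed hx rfl fun p _ q _ hpq hp =>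
      (SimpleGraph.ConnectedComponent.mem_supp_congr_adj _ hpq).1 hp
  · intro y hy
    obtain ⟨w⟩ := (SimpleGraph.ConnectedComponent.exact hy).symm
    induction w with
    | nil => exact hx
    | cons h w ih =>
      rcases hK.2.2 _ hx _ h with h' | h'
      · exact ih h' ((SimpleGraph.ConnectedComponent.mem_supp_iff _ _).2
          (SimpleGraph.ConnectedComponent.sound w.reachable.symm))
      · simp at h'

lemma lambda_eq : lambda G = (difficultSets G ∅).card := by
  classical
  rw [← Fintype.card_coe, ← Nat.card_eq_fintype_card, lambda]
  refine Nat.card_eq_of_bijective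
    (fun c => ⟨(Set.toFinite c.1.supp).toFinset, mem_difficultSets.2
      ⟨(isDifficult_iff (by simp)).1 c.2, by simp, fun x hx y hxy => Or.inl ?_⟩⟩) ⟨?_, ?_⟩
  · rw [Set.Finite.mem_toFinset] at hx ⊢
    exact (SimpleGraph.ConnectedComponent.mem_supp_congr_adj _ hxy).1 hx
  · intro c d hcd
    simp only [Subtype.mk.injEq, Set.Finite.toFinset_inj] at hcd
    exact Subtype.ext (SimpleGraph.ConnectedComponent.supp_injective hcd)
  · rintro ⟨K, hK⟩
    rw [mem_difficultSets] at hK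
    obtain ⟨c, hc⟩ := hK.exists_component
    refine ⟨⟨c, (isDifficult_iff hc).2 hK.1⟩, ?_⟩
    exact Subtype.ext (Finset.coe_injective (by rw [Set.Finite.coe_toFinset, hc]))

lemma lambda_deleteSet_le (S : Finset V) :
    lambda (deleteSet G S) ≤ (difficultSets G S).card := by
  classical
  rw [lambda_eq]
  refine Finset.card_le_card_of_injOn (fun K => K.map (Function.Embedding.subtype _)) ?_
    (Finset.map_injective _).injOn
  intro K hK
  rw [Finset.mem_coe, mem_difficultSets] at hK ⊢
  refine ⟨?_, ?_, ?_⟩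
  · rcases hK.1 with ⟨x, y, z, h1, h2, h3, rfl⟩ | ⟨x, y, z, p, q, r, h1, h2, h3, h4, h5, h6, h7,
      h8, h9, h10, h11, h12, h13, h14, h15, rfl⟩
    · exact Or.inl ⟨x, y, z, h1, h2, h3, by simp⟩
    · exact Or.inr ⟨x, y, z, p, q, r, h1, h2, h3, h4, h5, h6, h7,
        h8, h9, h10, h11, h12, h13, h14, h15, by simp⟩
  · rw [Finset.disjoint_right]
    intro x hx
    obtain ⟨y, -, rfl⟩ := Finset.mem_map.1 hx
    exact y.2
  · intro x hx y hxy
    obtain ⟨x, hx', rfl⟩ := Finset.mem_map.1 hx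
    by_cases hy : y ∈ S
    · exact Or.inr hy
    · rcases hK.2.2 x hx' ⟨y, hy⟩ hxy with h | h
      · exact Or.inl (Finset.mem_map.2 ⟨_, h, rfl⟩)
      · simp at h

variable (G) in
/-- `I` is an independent set contained in `S` together with its neighbourhood. -/
def IsClosedPair (S I : Finset V) : Prop :=
  I ⊆ S ∧ IsIndepSet G I ∧ ∀ x ∈ I, ∀ y, G.Adj x y → y ∈ S

variable (G) in
/-- `G` has no set of `s` vertices containing an independent set of size `k` and its
neighbourhood, whose deletion destroys at least `N` edges more than it creates difficult
components. -/
def NoReduction (s k N : ℕ) : Prop :=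
  ∀ S I : Finset V, S.card = s → I.card = k → IsClosedPair G S I →
    2 * cut G Finset.univ S + 2 * (difficultSets G ∅).card <
      2 * N + 2 * (difficultSets G S).card + cut G S S

lemma noReduction {a b : ℝ} (hb : 0 < b) (hG : ¬ HasTriangleAdjC4 G)
    (hcex : (indepNum G : ℝ) <
      (Nat.card V : ℝ) - (a * Nat.card V + b * numEdges G + b * lambda G))
    (hmin : ∀ (W : Type) [Fintype W] (G' : SimpleGraph W),
      Nat.card W < Nat.card V → ¬ HasTriangleAdjC4 G' →
      (indepNum G' : ℝ) ≥
        (Nat.card W : ℝ) - (a * Nat.card W + b * numEdges G' + b * lambda G'))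
    {s k N : ℕ} (hs : 0 < s) (h : (s : ℝ) - k ≤ a * s + b * N) : NoReduction G s k N := by
  intro S I hS hI ⟨hIS, hind, hcl⟩
  have hcard : Nat.card {x // x ∉ S} + s = Nat.card V := by
    rw [Nat.card_eq_fintype_card, Nat.card_eq_fintype_card, Fintype.card_subtype_compl,
      Fintype.card_coe, hS]
    have := S.card_le_univ
    omega
  have hα := card_add_indepNum_deleteSet_le hind hIS hcl
  have hm := hmin {x // x ∉ S} (deleteSet G S) (by omega) fun ⟨u, v, w, x, y, h1, h2, h3, h4, h5,
    h6, h7, h8⟩ => hG ⟨u, v, w, x, y, h1, h2, h3, h4, h5, h6,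
      fun h => h7 (Subtype.ext h), fun h => h8 (Subtype.ext h)⟩
  have he := two_mul_numEdges_eq (G := G) S
  have hl := lambda_deleteSet_le (G := G) S
  rw [lambda_eq] at hcex
  rw [hI] at hα
  by_contra hcon
  have hcon' : 2 * N + 2 * lambda (deleteSet G S) + 2 * numEdges (deleteSet G S) ≤
      2 * numEdges G + 2 * (difficultSets G ∅).card := by omega
  have hr : (N : ℝ) + lambda (deleteSet G S) + numEdges (deleteSet G S) ≤
      numEdges G + (difficultSets G ∅).card := by
    have : N + lambda (deleteSet G S) + numEdges (deleteSet G S) ≤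
      numEdges G + (difficultSets G ∅).card := by omega
    exact_mod_cast this
  have hr' := mul_le_mul_of_nonneg_left hr hb.le
  have hα' : (k : ℝ) + indepNum (deleteSet G S) ≤ indepNum G := by exact_mod_cast hα
  have hcard' : (Nat.card {x // x ∉ S} : ℝ) + s = Nat.card V := by exact_mod_cast hcard
  rw [← hcard'] at hcex
  linarith

end MinimalCounterexample

section Structure

set_option linter.unusedSectionVars false

variable {V : Type} [Fintype V] [DecidableEq V] {G : SimpleGraph V} [DecidableRel G.Adj]

lemma NoReduction.lt {s k N : ℕ} (h : NoReduction G s k N) {S I : Finset V} (hS : S.card = s)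
    (hI : I.card = k) (hSI : IsClosedPair G S I) :
    2 * cut G Finset.univ S < 2 * N + 2 * (touchingSets G S).card + cut G S S := by
  have h₁ := h S I hS hI hSI
  have h₂ := card_difficultSets_le (G := G) S
  omega

lemma card_touchingSets_add_le (S : Finset V) :
    (touchingSets G S).card + cut G S S ≤ cut G Finset.univ S := by
  simpa using mul_card_touchingSets_add_le (m := 1) fun K hK => (mem_touchingSets.1 hK).2

lemma cut_univ_union {S K : Finset V} (hK : IsDifficultSet G S K) :
    cut G Finset.univ (S ∪ K) = cut G Finset.univ S + cut G K K + cut G S K := by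
  rw [cut_union_right _ hK.disjoint, hK.cut_univ, add_assoc]

lemma cut_union_self {S K : Finset V} (hK : IsDifficultSet G S K) :
    cut G (S ∪ K) (S ∪ K) = cut G S S + cut G K K + 2 * cut G S K := by
  rw [cut_union_right _ hK.disjoint, cut_union_left hK.disjoint, cut_union_left hK.disjoint,
    cut_comm K S]
  ring

lemma cut_insert_self {A : Finset V} {a : V} (h : a ∉ A) :
    cut G (insert a A) (insert a A) = cut G A A + 2 * nbrCount G A a := by
  rw [cut_insert _ h, nbrCount_insert h, cut_comm, cut_insert _ h]
  simp
  ring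

lemma even_cut_self (A : Finset V) : Even (cut G A A) := by
  induction A using Finset.induction_on with
  | empty => exact ⟨0, rfl⟩
  | insert a A h ih =>
    rw [cut_insert_self h]
    exact ih.add (even_two_mul _)

lemma isClosedPair_singleton {S : Finset V} {v : V} (hv : v ∈ S) (h : ∀ y, G.Adj v y → y ∈ S) :
    IsClosedPair G S {v} := by
  refine ⟨by simpa using hv, ?_, by simpa using h⟩
  intro x hx y hy
  rw [Finset.mem_singleton] at hx hy
  rw [hx, hy]
  exact G.irrefl

lemma IsClosedPair.union {S I K J : Finset V} (h : IsClosedPair G S I) (hK : IsDifficultSet G S K)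
    (hJK : J ⊆ K) (hJ : IsIndepSet G J) :
    IsClosedPair G (S ∪ K) (I ∪ J) ∧ (I ∪ J).card = I.card + J.card := by
  refine ⟨⟨Finset.union_subset_union h.1 hJK, ?_, ?_⟩,
    Finset.card_union_of_disjoint (hK.disjoint.mono h.1 hJK)⟩
  · have hIJ : ∀ x ∈ I, ∀ y ∈ J, ¬ G.Adj x y := fun x hx y hy hxy =>
      Finset.disjoint_left.1 hK.disjoint (h.2.2 x hx y hxy) (hJK hy)
    intro x hx y hy
    rcases Finset.mem_union.1 hx with hx | hx <;> rcases Finset.mem_union.1 hy with hy | hy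
    · exact h.2.1 x hx y hy
    · exact hIJ x hx y hy
    · exact fun hxy => hIJ y hy x hx hxy.symm
    · exact hJ x hx y hy
  · intro x hx y hxy
    rw [Finset.mem_union]
    rcases Finset.mem_union.1 hx with hx | hx
    · exact Or.inl (h.2.2 x hx y hxy)
    · exact (hK.2.2 x (hJK hx) y hxy).symm

lemma IsClosedPair.exists_union_triangle {S I K : Finset V} (h : IsClosedPair G S I)
    (hK : IsDifficultSet G S K) (hT : IsTriangleSet G K) :
    ∃ I', IsClosedPair G (S ∪ K) I' ∧ I'.card = I.card + 1 := by
  obtain ⟨x, y, z, -, -, -, rfl⟩ := hT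
  exact ⟨_, h.union hK (J := {x}) (by simp) (by simp [IsIndepSet])⟩

lemma IsClosedPair.exists_union_chain {S I K : Finset V} (h : IsClosedPair G S I)
    (hK : IsDifficultSet G S K) (hC : IsChainSet G K) :
    ∃ I', IsClosedPair G (S ∪ K) I' ∧ I'.card = I.card + 2 := by
  obtain ⟨x, y, z, p, q, r, h1, h2, h3, h4, h5, h6, h7, h8, h9, h10, h11, h12, h13, h14, h15,
    rfl⟩ := hC
  have hne := chain_ne h1 h2 h3 h4 h5 h6 h7 h8 h9 h10 h11 h12 h13
  have hp := h.union hK (J := {x, q}) (by grind) (by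
    intro s hs t ht hst
    simp only [Finset.mem_insert, Finset.mem_singleton] at hs ht
    rcases hs with rfl | rfl <;> rcases ht with rfl | rfl
    · exact G.irrefl hst
    · exact h9 hst
    · exact h9 hst.symm
    · exact G.irrefl hst)
  rw [Finset.card_pair hne.2.2.2.1] at hp
  exact ⟨_, hp⟩

lemma eq_of_two_triangles (hG : ¬ HasTriangleAdjC4 G) {x y z p : V} (hxy : G.Adj x y)
    (hxz : G.Adj x z) (hyz : G.Adj y z) (hxp : G.Adj x p) (hyp : G.Adj y p) : z = p := by
  by_contra hne
  exact hG ⟨x, z, y, y, p, hxz, hyz.symm, hxy.symm, hyz.symm, hyp, hxp.symm, hxy.ne, hne⟩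

lemma nbrCount_eq_card (A : Finset V) (x : V) : nbrCount G A x = {y ∈ A | G.Adj x y}.card := by
  simp [nbrCount]

lemma deg_eq_card (v : V) : deg G v = (G.neighborFinset v).card := by
  rw [deg, Nat.card_eq_fintype_card, SimpleGraph.card_neighborSet_eq_degree,
    SimpleGraph.card_neighborFinset_eq_degree]

lemma IsTriangleSet.exists_pair {T : Finset V} (hT : IsTriangleSet G T) {a : V} (ha : a ∈ T) :
    ∃ y z, G.Adj a y ∧ G.Adj y z ∧ G.Adj a z ∧ T = {a, y, z} := by
  obtain ⟨x, y, z, hxy, hyz, hxz, rfl⟩ := hT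
  simp only [Finset.mem_insert, Finset.mem_singleton] at ha
  rcases ha with rfl | rfl | rfl
  · exact ⟨y, z, hxy, hyz, hxz, rfl⟩
  · exact ⟨x, z, hxy.symm, hxz, hyz, Finset.insert_comm _ _ _⟩
  · exact ⟨x, y, hxz.symm, hxy, hyz.symm, by ext; simp; tauto⟩

lemma IsTriangleSet.exists_third {T : Finset V} (hT : IsTriangleSet G T) {a b : V} (ha : a ∈ T)
    (hb : b ∈ T) (hab : a ≠ b) :
    G.Adj a b ∧ ∃ c, G.Adj a c ∧ G.Adj b c ∧ T = {c, a, b} := by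
  obtain ⟨y, z, hay, hyz, haz, rfl⟩ := hT.exists_pair ha
  simp only [Finset.mem_insert, Finset.mem_singleton] at hb
  rcases hb with rfl | rfl | rfl
  · exact absurd rfl hab
  · exact ⟨hay, z, haz, hyz, by ext; simp; tauto⟩
  · exact ⟨haz, y, hay, hyz.symm, Finset.insert_comm _ _ _⟩

lemma IsTriangleSet.nbrCount_le_one (hG : ¬ HasTriangleAdjC4 G) {T : Finset V}
    (hT : IsTriangleSet G T) {p : V} (hp : p ∉ T) : nbrCount G T p ≤ 1 := by
  rw [nbrCount_eq_card, Finset.card_le_one]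
  intro a ha b hb
  rw [Finset.mem_filter] at ha hb
  by_contra hne
  obtain ⟨hab, c, hac, hbc, rfl⟩ := hT.exists_third ha.1 hb.1 hne
  have := eq_of_two_triangles hG hab hac hbc ha.2.symm hb.2.symm
  simp [this] at hp

lemma IsChainSet.exists_triangles {K : Finset V} (hK : IsChainSet G K) :
    ∃ T₁ T₂, IsTriangleSet G T₁ ∧ IsTriangleSet G T₂ ∧ Disjoint T₁ T₂ ∧ K = T₁ ∪ T₂ := by
  obtain ⟨x, y, z, p, q, r, h1, h2, h3, h4, h5, h6, h7, h8, h9, h10, h11, h12, h13, h14, h15,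
    rfl⟩ := hK
  have hne := chain_ne h1 h2 h3 h4 h5 h6 h7 h8 h9 h10 h11 h12 h13
  refine ⟨{x, y, z}, {p, q, r}, ⟨x, y, z, h1, h2, h3, rfl⟩, ⟨p, q, r, h4, h5, h6, rfl⟩, ?_, ?_⟩
  · simp [hne, Ne.symm]
  · ext; simp; tauto

lemma IsChainSet.nbrCount_le_two (hG : ¬ HasTriangleAdjC4 G) {K : Finset V}
    (hK : IsChainSet G K) {p : V} (hp : p ∉ K) : nbrCount G K p ≤ 2 := by
  obtain ⟨T₁, T₂, h₁, h₂, hd, rfl⟩ := hK.exists_triangles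
  rw [Finset.mem_union, not_or] at hp
  rw [nbrCount_union hd]
  have := h₁.nbrCount_le_one hG hp.1
  have := h₂.nbrCount_le_one hG hp.2
  omega

lemma IsDifficultSet.mul_card_le {S K : Finset V} (hK : IsDifficultSet G S K) {d : ℕ}
    (hd : ∀ x ∈ K, d ≤ deg G x) : d * K.card ≤ cut G K K + cut G S K := by
  rw [← hK.cut_univ, mul_comm, ← smul_eq_mul]
  exact Finset.card_nsmul_le_sum _ _ _ fun x hx => by rw [nbrCount_univ]; exact hd x hx

lemma IsDifficultSet.le_cut_of_triangle {S K : Finset V} (hK : IsDifficultSet G S K)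
    (hT : IsTriangleSet G K) {d : ℕ} (hd : ∀ x ∈ K, d ≤ deg G x) : 3 * d ≤ 6 + cut G S K := by
  have := hK.mul_card_le hd
  rw [hT.card_eq, hT.cut_self] at this
  omega

lemma IsDifficultSet.le_cut_of_chain {S K : Finset V} (hK : IsDifficultSet G S K)
    (hC : IsChainSet G K) {d : ℕ} (hd : ∀ x ∈ K, d ≤ deg G x) : 6 * d ≤ 14 + cut G S K := by
  have := hK.mul_card_le hd
  rw [hC.card_eq, hC.cut_self] at this
  omega

lemma IsDifficultSet.three_le_cut {S K : Finset V} (hK : IsDifficultSet G S K)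
    (hd : ∀ x ∈ K, 3 ≤ deg G x) : 3 ≤ cut G S K := by
  rcases hK.1 with h | h
  · have := hK.le_cut_of_triangle h hd; omega
  · have := hK.le_cut_of_chain h hd; omega

lemma three_mul_card_touchingSets_add_le (hd : ∀ x, 3 ≤ deg G x) (S : Finset V) :
    3 * (touchingSets G S).card + cut G S S ≤ cut G Finset.univ S :=
  mul_card_touchingSets_add_le fun _ hK =>
    (mem_touchingSets.1 hK).1.three_le_cut fun x _ => hd x

end Structure

section MinDegree

set_option linter.unusedSectionVars false

variable {V : Type} [Fintype V] [DecidableEq V] {G : SimpleGraph V} [DecidableRel G.Adj]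

lemma cut_eq_card (A B : Finset V) :
    cut G A B = {e ∈ B ×ˢ A | G.Adj e.1 e.2}.card := by
  simp only [cut, nbrCount, Finset.card_filter, Finset.sum_product]

lemma eq_of_cut_le_one {A B : Finset V} (h : cut G A B ≤ 1) {a a' b b' : V} (ha : a ∈ A)
    (ha' : a' ∈ A) (hb : b ∈ B) (hb' : b' ∈ B) (hab : G.Adj b a) (hab' : G.Adj b' a') :
    b = b' ∧ a = a' := by
  rw [cut_eq_card, Finset.card_le_one] at h
  simpa using h (b, a) (by simp [*]) (b', a') (by simp [*])

lemma cut_pair {u v : V} (h : G.Adj u v) : cut G {u, v} {u, v} = 2 := by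
  rw [cut_insert_self (by simpa using h.ne), cut_singleton, nbrCount_singleton,
    nbrCount_singleton]
  simp [h]

lemma mem_of_adj_of_deg_le {A : Finset V} {v : V} (hA : ∀ x ∈ A, G.Adj v x)
    (h : deg G v ≤ A.card) {y : V} (hy : G.Adj v y) : y ∈ A := by
  rw [deg_eq_card] at h
  rw [Finset.eq_of_subset_of_card_le (fun x hx => by simpa using hA x hx) h]
  simpa using hy

lemma mem_of_adj_of_cut_le {S : Finset V} (h : cut G Finset.univ S ≤ cut G S S) {x y : V}
    (hx : x ∈ S) (hxy : G.Adj x y) : y ∈ S := by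
  by_contra hy
  have h₁ : 1 ≤ cut G S Sᶜ := cut_pos.2 ⟨y, by simpa using hy, x, hx, hxy.symm⟩
  have h₂ := cut_univ_split (G := G) S
  omega

lemma two_le_deg (h0 : NoReduction G 1 1 0) (h1 : NoReduction G 2 1 1) (v : V) :
    2 ≤ deg G v := by
  by_contra! hv
  obtain hv | hv : deg G v = 0 ∨ deg G v = 1 := by omega
  · have hlt := h0.lt (S := {v}) (by simp) (by simp) (isClosedPair_singleton (by simp)
      fun y hy => absurd (mem_of_adj_of_deg_le (A := ∅) (by simp) hv.le hy) (by simp))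
    have := card_touchingSets_add_le (G := G) {v}
    omega
  · rw [deg_eq_card, Finset.card_eq_one] at hv
    obtain ⟨u, hu⟩ := hv
    have huv : ∀ y, G.Adj v y ↔ y = u := fun y => by
      rw [← SimpleGraph.mem_neighborFinset, hu, Finset.mem_singleton]
    have hvu : G.Adj v u := (huv u).2 rfl
    have hlt := h1.lt (S := {v, u}) (Finset.card_pair hvu.ne) (Finset.card_singleton v)
      (isClosedPair_singleton (by simp) fun y hy => by simp [(huv y).1 hy])
    have := card_touchingSets_add_le (G := G) {v, u}
    rw [cut_pair hvu] at *
    omega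

lemma isChainSet_union {S K : Finset V} (hS : IsTriangleSet G S) (hK : IsTriangleSet G K)
    (hd : Disjoint S K) (h : cut G S K = 1) : IsChainSet G (S ∪ K) := by
  obtain ⟨p, hp, z, hz, hpz⟩ := cut_pos.1 h.ge
  obtain ⟨x, y, hzx, hxy, hzy, rfl⟩ := hS.exists_pair hz
  obtain ⟨q, r, hpq, hqr, hpr, rfl⟩ := hK.exists_pair hp
  have hn : ∀ a ∈ ({z, x, y} : Finset V), ∀ b ∈ ({p, q, r} : Finset V), G.Adj a b →
      p = b ∧ z = a := fun a ha b hb hab => eq_of_cut_le_one h.le hz ha hp hb hpz hab.symm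
  refine ⟨x, y, z, p, q, r, hxy, hzy.symm, hzx.symm, hpq, hqr, hpr, hpz.symm,
    ?_, ?_, ?_, ?_, ?_, ?_, ?_, ?_, by ext; simp; tauto⟩ <;> intro hadj
  · exact hzx.ne (hn _ (by simp) _ (by simp) hadj).2
  · exact hzx.ne (hn _ (by simp) _ (by simp) hadj).2
  · exact hzx.ne (hn _ (by simp) _ (by simp) hadj).2
  · exact hzy.ne (hn _ (by simp) _ (by simp) hadj).2
  · exact hzy.ne (hn _ (by simp) _ (by simp) hadj).2
  · exact hzy.ne (hn _ (by simp) _ (by simp) hadj).2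
  · exact hpq.ne (hn _ (by simp) _ (by simp) hadj).1
  · exact hpr.ne (hn _ (by simp) _ (by simp) hadj).1

lemma three_le_deg_of_triangle (h2 : NoReduction G 3 1 4) (h2' : NoReduction G 6 2 8)
    (h3 : NoReduction G 9 3 11) {u v w : V} (hvu : G.Adj v u) (huw : G.Adj u w)
    (hvw : G.Adj v w) : 3 ≤ deg G v := by
  by_contra! hv
  have hT : IsTriangleSet G {v, u, w} := ⟨v, u, w, hvu, huw, hvw, rfl⟩
  have hcl : IsClosedPair G {v, u, w} {v} := isClosedPair_singleton (by simp) fun y hy =>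
    Finset.mem_insert_of_mem (mem_of_adj_of_deg_le (A := {u, w}) (by simp [hvu, hvw])
      (by rw [Finset.card_pair huw.ne]; omega) hy)
  generalize ({v, u, w} : Finset V) = T at hT hcl
  have hraw := h2 T _ hT.card_eq (by simp) hcl
  have hle := card_difficultSets_le (G := G) T
  have hsplit := cut_univ_split (G := G) T
  have ht := card_touchingSets_add_le (G := G) T
  have hself := hT.cut_self
  have htri : ∀ K ∈ touchingSets G T, IsTriangleSet G K := by
    intro K hK
    obtain ⟨hK, hc⟩ := mem_touchingSets.1 hK
    refine hK.1.resolve_right fun hC => ?_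
    obtain ⟨I, hI, hIc⟩ := hcl.exists_union_chain hK hC
    have hlt := h3.lt (by rw [Finset.card_union_of_disjoint hK.disjoint, hT.card_eq, hC.card_eq])
      (by simpa using hIc) hI
    have ht' := card_touchingSets_add_le (G := G) (T ∪ K)
    rw [cut_univ_union hK, cut_union_self hK, hC.cut_self] at *
    omega
  have hone : (touchingSets G T).card ≤ 1 := by
    rw [Finset.card_le_one]
    intro K hK L hL
    by_contra hne
    have hKt := htri K hK
    have hLt := htri L hL
    obtain ⟨hK, hc⟩ := mem_touchingSets.1 hK
    obtain ⟨hL, hc'⟩ := mem_touchingSets.1 hL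
    have hKL := hK.union_left hL hne
    obtain ⟨I, hI, hIc⟩ := hcl.exists_union_triangle hK hKt
    obtain ⟨J, hJ, hJc⟩ := hI.exists_union_triangle hKL hLt
    have hlt := h3.lt (by rw [Finset.card_union_of_disjoint hKL.disjoint,
      Finset.card_union_of_disjoint hK.disjoint, hT.card_eq, hKt.card_eq, hLt.card_eq])
      (by simp [hJc, hIc]) hJ
    have ht' := card_touchingSets_add_le (G := G) (T ∪ K ∪ L)
    rw [cut_univ_union hKL, cut_union_self hKL, cut_univ_union hK, cut_union_self hK,
      hKt.cut_self, hLt.cut_self, cut_union_left hK.disjoint, hK.cut_eq_zero hL hne] at *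
    omega
  obtain h | h : (touchingSets G T).card = 0 ∨ (touchingSets G T).card = 1 := by omega
  · have hD : IsDifficultSet G ∅ T := ⟨Or.inl hT, by simp, fun x hx y hxy =>
      Or.inl (mem_of_adj_of_cut_le (by omega) hx hxy)⟩
    have := hD.card_lt
    omega
  · obtain ⟨K, hKt⟩ := Finset.card_eq_one.1 h
    have hKT : K ∈ touchingSets G T := by simp [hKt]
    have hKtri := htri K hKT
    obtain ⟨hK, hc⟩ := mem_touchingSets.1 hKT
    have hsum := sum_touchingSets_add_le (G := G) T
    rw [hKt, Finset.sum_singleton] at hsum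
    have hC := isChainSet_union hT hKtri hK.disjoint (by omega)
    obtain ⟨I, hI, hIc⟩ := hcl.exists_union_triangle hK hKtri
    have hraw' := h2' _ _ hC.card_eq (by simpa using hIc) hI
    have hU := cut_univ_union hK
    have hself' := hC.cut_self
    have hKself := hKtri.cut_self
    have hD : IsDifficultSet G ∅ (T ∪ K) := ⟨Or.inr hC, by simp, fun x hx y hxy =>
      Or.inl (mem_of_adj_of_cut_le (by omega) hx hxy)⟩
    have := hD.card_lt
    omega

lemma IsDifficultSet.three_le_deg (htri : ∀ {u v w : V}, G.Adj v u → G.Adj u w → G.Adj v w →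
    3 ≤ deg G v) {S K : Finset V} (hK : IsDifficultSet G S K) {x : V} (hx : x ∈ K) :
    3 ≤ deg G x := by
  obtain ⟨T, hT, hxT⟩ : ∃ T, IsTriangleSet G T ∧ x ∈ T := by
    rcases hK.1 with h | h
    · exact ⟨K, h, hx⟩
    · obtain ⟨T₁, T₂, h₁, h₂, -, rfl⟩ := h.exists_triangles
      rcases Finset.mem_union.1 hx with hx | hx
      exacts [⟨T₁, h₁, hx⟩, ⟨T₂, h₂, hx⟩]
  obtain ⟨y, z, hxy, hyz, hxz, -⟩ := hT.exists_pair hxT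
  exact htri hxy hyz hxz

lemma three_le_deg (h0 : NoReduction G 1 1 0) (h1 : NoReduction G 2 1 1)
    (h2 : NoReduction G 3 1 4) (h2' : NoReduction G 6 2 8) (h3 : NoReduction G 9 3 11) (v : V) :
    3 ≤ deg G v := by
  have htri : ∀ {u v w : V}, G.Adj v u → G.Adj u w → G.Adj v w → 3 ≤ deg G v :=
    three_le_deg_of_triangle h2 h2' h3
  have hmin := two_le_deg h0 h1
  by_contra! hv
  have hv2 : deg G v = 2 := by have := hmin v; omega
  have hN := hv2
  rw [deg_eq_card, Finset.card_eq_two] at hN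
  obtain ⟨u, w, huw, hN⟩ := hN
  have hadj : ∀ y, G.Adj v y ↔ y = u ∨ y = w := fun y => by
    rw [← SimpleGraph.mem_neighborFinset, hN, Finset.mem_insert, Finset.mem_singleton]
  have hvu := (hadj u).2 (Or.inl rfl)
  have hvw := (hadj w).2 (Or.inr rfl)
  have hnuw : ¬ G.Adj u w := fun h => by have := htri hvu h hvw; omega
  have hvS : v ∉ ({u, w} : Finset V) := by simp [hvu.ne, hvw.ne]
  have huS : u ∉ ({w} : Finset V) := by simpa using huw
  have hlt := h2.lt (S := {v, u, w}) (by rw [Finset.card_insert_of_notMem hvS,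
    Finset.card_pair huw]) (Finset.card_singleton v)
    (isClosedPair_singleton (by simp) fun y hy => by
      rcases (hadj y).1 hy with rfl | rfl <;> simp)
  have ht : 3 * (touchingSets G {v, u, w}).card + cut G {v, u, w} {v, u, w} ≤
      cut G Finset.univ {v, u, w} := mul_card_touchingSets_add_le fun K hK =>
    (mem_touchingSets.1 hK).1.three_le_cut fun x hx =>
      (mem_touchingSets.1 hK).1.three_le_deg htri hx
  have hself : cut G {v, u, w} {v, u, w} = 4 := by
    rw [cut_insert_self hvS, cut_insert_self huS, nbrCount_insert huS, cut_singleton]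
    simp [nbrCount_singleton, hvu, hvw, hnuw]
  have hU : cut G Finset.univ {v, u, w} = deg G v + (deg G u + deg G w) := by
    rw [cut_insert _ hvS, cut_insert _ huS, cut_singleton]
    simp only [nbrCount_univ]
  have := hmin u
  have := hmin w
  omega

lemma deg_le_four (hG : ¬ HasTriangleAdjC4 G) (hd : ∀ x, 3 ≤ deg G x)
    (h4 : NoReduction G 1 0 5) (v : V) : deg G v ≤ 4 := by
  have hlt := h4.lt (S := {v}) (I := ∅) (by simp) (by simp) ⟨by simp, by simp [IsIndepSet],
    by simp⟩
  have ht : touchingSets G {v} = ∅ := by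
    refine Finset.eq_empty_of_forall_notMem fun K hK => ?_
    obtain ⟨hK, -⟩ := mem_touchingSets.1 hK
    have hvK : v ∉ K := by simpa using hK.disjoint
    have hc : cut G {v} K = nbrCount G K v := by rw [cut_comm, cut_singleton]
    rcases hK.1 with h | h
    · have := hK.le_cut_of_triangle h fun x _ => hd x
      have := h.nbrCount_le_one hG hvK
      omega
    · have := hK.le_cut_of_chain h fun x _ => hd x
      have := h.nbrCount_le_two hG hvK
      omega
  rw [ht, cut_singleton, cut_singleton, nbrCount_univ, nbrCount_singleton] at hlt
  simp at hlt
  omega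

end MinDegree

section MaxDegree

set_option linter.unusedSectionVars false

variable {V : Type} [Fintype V] [DecidableEq V] {G : SimpleGraph V} [DecidableRel G.Adj]

lemma card_insert_neighborFinset (v : V) :
    (insert v (G.neighborFinset v)).card = deg G v + 1 := by
  rw [Finset.card_insert_of_notMem (by simp), deg_eq_card]

lemma isClosedPair_insert_neighborFinset (v : V) :
    IsClosedPair G (insert v (G.neighborFinset v)) {v} :=
  isClosedPair_singleton (by simp) fun y hy => by simp [hy]

lemma cut_insert_neighborFinset_self (v : V) :
    cut G (insert v (G.neighborFinset v)) (insert v (G.neighborFinset v)) =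
      cut G (G.neighborFinset v) (G.neighborFinset v) + 2 * deg G v := by
  rw [cut_insert_self (by simp), nbrCount_of_forall (by simp)]

lemma cut_univ_insert_neighborFinset (v : V) :
    cut G Finset.univ (insert v (G.neighborFinset v)) =
      deg G v + cut G Finset.univ (G.neighborFinset v) := by
  rw [cut_insert _ (by simp), nbrCount_univ]

lemma cut_le_mul_card {A B : Finset V} {m : ℕ} (h : ∀ x ∈ B, nbrCount G A x ≤ m) :
    cut G A B ≤ m * B.card := by
  rw [mul_comm, ← smul_eq_mul]
  exact Finset.sum_le_card_nsmul _ _ _ h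

lemma cut_neighborFinset_self_le (hG : ¬ HasTriangleAdjC4 G) (v : V) :
    cut G (G.neighborFinset v) (G.neighborFinset v) ≤ deg G v := by
  rw [deg_eq_card, ← one_mul (G.neighborFinset v).card]
  refine cut_le_mul_card fun u hu => ?_
  rw [nbrCount_eq_card, Finset.card_le_one]
  intro x hx y hy
  simp only [Finset.mem_filter, SimpleGraph.mem_neighborFinset] at hu hx hy
  exact eq_of_two_triangles hG hu hx.1 hx.2 hy.1 hy.2

lemma IsDifficultSet.cut_insert_neighborFinset {v : V} {K : Finset V}
    (hK : IsDifficultSet G (insert v (G.neighborFinset v)) K) :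
    cut G (insert v (G.neighborFinset v)) K = cut G K (G.neighborFinset v) := by
  rw [cut_comm, cut_insert _ (by simp), Nat.add_eq_right]
  by_contra h
  obtain ⟨y, hy, hvy⟩ := nbrCount_pos.1 (Nat.one_le_iff_ne_zero.2 h)
  exact Finset.disjoint_left.1 hK.disjoint (by simp [hvy]) hy

lemma IsDifficultSet.cut_insert_neighborFinset_le {v : V} {K : Finset V}
    (hK : IsDifficultSet G (insert v (G.neighborFinset v)) K) {m : ℕ}
    (hm : ∀ x ∉ K, nbrCount G K x ≤ m) :
    cut G (insert v (G.neighborFinset v)) K ≤ m * deg G v := by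
  rw [hK.cut_insert_neighborFinset, deg_eq_card]
  exact cut_le_mul_card fun x hx =>
    hm x (Finset.disjoint_left.1 hK.disjoint (Finset.mem_insert_of_mem hx))

lemma exists_adj_of_deg_eq_four (hG : ¬ HasTriangleAdjC4 G) (h8 : NoReduction G 5 1 14) {v : V}
    (hv : deg G v = 4) : ∃ x y, G.Adj x y ∧ deg G x = 4 ∧ deg G y ≠ 4 := by
  by_contra! hall
  have hlt := h8.lt ((card_insert_neighborFinset v).trans (by rw [hv])) (by simp)
    (isClosedPair_insert_neighborFinset v)
  have hn := cut_neighborFinset_self_le hG v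
  have hU : cut G Finset.univ (G.neighborFinset v) = 4 * 4 := by
    rw [cut, Finset.sum_congr rfl fun x hx => (nbrCount_univ x).trans
      (hall v x (by simpa using hx) hv)]
    rw [Finset.sum_const, smul_eq_mul, ← deg_eq_card, hv]
  have ht : touchingSets G (insert v (G.neighborFinset v)) = ∅ := by
    refine Finset.eq_empty_of_forall_notMem fun K hK => ?_
    obtain ⟨hK, hc⟩ := mem_touchingSets.1 hK
    obtain ⟨x, hx, y, hy, hxy⟩ := cut_pos.1 hc
    have hy4 : deg G y = 4 := by
      rcases Finset.mem_insert.1 hy with rfl | hy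
      exacts [hv, hall v y (by simpa using hy) hv]
    have hK4 := hK.subset_of_closed (C := {x | deg G x = 4}) hx (hall y x hxy.symm hy4)
      fun p _ q _ hpq hp => hall p q hpq hp
    rcases hK.1 with h | h
    · have := hK.le_cut_of_triangle h fun x hx => (hK4 hx).ge
      have := hK.cut_insert_neighborFinset_le fun x => h.nbrCount_le_one hG
      omega
    · have := hK.le_cut_of_chain h fun x hx => (hK4 hx).ge
      have := hK.cut_insert_neighborFinset_le fun x => h.nbrCount_le_two hG
      omega
  rw [ht, cut_insert_neighborFinset_self, cut_univ_insert_neighborFinset, hU, hv] at hlt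
  simp at hlt
  omega

lemma eq_of_nbrCount_le_one {A : Finset V} {x y z : V} (h : nbrCount G A x ≤ 1) (hy : y ∈ A)
    (hz : z ∈ A) (hxy : G.Adj x y) (hxz : G.Adj x z) : y = z := by
  rw [nbrCount_eq_card, Finset.card_le_one] at h
  exact h y (by simp [*]) z (by simp [*])

lemma IsTriangleSet.nbrCount_le_two {T : Finset V} (hT : IsTriangleSet G T) {x : V}
    (hx : x ∈ T) : nbrCount G T x ≤ 2 := by
  have h : {y ∈ T | G.Adj x y} ⊆ T.erase x := fun y hy => by
    rw [Finset.mem_filter] at hy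
    exact Finset.mem_erase.2 ⟨hy.2.ne', hy.1⟩
  have := Finset.card_le_card h
  rw [Finset.card_erase_of_mem hx, hT.card_eq] at this
  rwa [nbrCount_eq_card]

/-- A triangle joined by only three edges to `S` has at most one edge at each vertex. -/
lemma IsDifficultSet.nbrCount_le_one_of_triangle (hd : ∀ x, 3 ≤ deg G x) {S K : Finset V}
    (hK : IsDifficultSet G S K) (hT : IsTriangleSet G K) (hc : cut G S K ≤ 3) {x : V}
    (hx : x ∈ K) : nbrCount G S x ≤ 1 := by
  have hS : ∀ y ∈ K, 1 ≤ nbrCount G S y := fun y hy => by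
    have := hK.deg_eq hy
    have := hT.nbrCount_le_two hy
    have := hd y
    omega
  obtain ⟨y, z, hxy, hyz, hxz, rfl⟩ := hT.exists_pair hx
  have := hS y (by simp)
  have := hS z (by simp)
  rw [cut_insert _ (by simp [hxy.ne, hxz.ne]), cut_insert _ (by simp [hyz.ne]),
    cut_singleton] at hc
  omega

lemma IsDifficultSet.exists_pair_of_chain (hG : ¬ HasTriangleAdjC4 G) (hd : ∀ x, 3 ≤ deg G x)
    {S K : Finset V} (hK : IsDifficultSet G S K) (hC : IsChainSet G K) (hc : cut G S K ≤ 4)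
    {v : V} (hv : v ∈ S) (hvK : 2 ≤ nbrCount G K v) :
    ∃ q ∈ K, ∃ r ∈ K, q ≠ r ∧ ¬ G.Adj q r ∧ G.Adj v q ∧ G.Adj v r ∧ nbrCount G S q ≤ 1 ∧
      nbrCount G S r ≤ 1 := by
  have hvnK : v ∉ K := Finset.disjoint_left.1 hK.disjoint hv
  obtain ⟨x, y, z, p, q, r, h1, h2, h3, h4, h5, h6, h7, h8, h9, h10, h11, h12, h13, h14, h15,
    rfl⟩ := hC
  have hne := chain_ne h1 h2 h3 h4 h5 h6 h7 h8 h9 h10 h11 h12 h13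
  have hs : ∀ s t, ¬ G.Adj s t → ¬ G.Adj t s := fun s t hst hts => hst hts.symm
  have hx : nbrCount G {x, y, z, p, q, r} x = 2 := by
    simp [nbrCount, hne, h1, h3, h8, h9, h10, -Finset.sum_boole]
  have hy : nbrCount G {x, y, z, p, q, r} y = 2 := by
    simp [nbrCount, hne, h1.symm, h2, h11, h12, h13, -Finset.sum_boole]
  have hq : nbrCount G {x, y, z, p, q, r} q = 2 := by
    simp [nbrCount, hne, h4.symm, h5, hs _ _ h9, hs _ _ h12, hs _ _ h14, -Finset.sum_boole]
  have hr : nbrCount G {x, y, z, p, q, r} r = 2 := by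
    simp [nbrCount, hne, h5.symm, h6.symm, hs _ _ h10, hs _ _ h13, hs _ _ h15,
      -Finset.sum_boole]
  have ex := hK.deg_eq (x := x) (by simp)
  have ey := hK.deg_eq (x := y) (by simp)
  have eq := hK.deg_eq (x := q) (by simp)
  have er := hK.deg_eq (x := r) (by simp)
  have := hd x
  have := hd y
  have := hd q
  have := hd r
  have hcut : cut G S {x, y, z, p, q, r} = nbrCount G S x + (nbrCount G S y + (nbrCount G S z +
      (nbrCount G S p + (nbrCount G S q + nbrCount G S r)))) := by
    simp [cut, hne]
  have hz0 : ¬ G.Adj z v := fun h => by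
    have := nbrCount_pos.2 ⟨v, hv, h⟩
    omega
  have hp0 : ¬ G.Adj p v := fun h => by
    have := nbrCount_pos.2 ⟨v, hv, h⟩
    omega
  have hu : ({x, y, z, p, q, r} : Finset V) = {x, y, z} ∪ {p, q, r} := by
    simp only [Finset.insert_union, Finset.singleton_union]
  rw [hu, Finset.mem_union, not_or] at hvnK
  have hT₁ : nbrCount G {x, y, z} v ≤ 1 :=
    IsTriangleSet.nbrCount_le_one hG ⟨x, y, z, h1, h2, h3, rfl⟩ hvnK.1
  have hT₂ : nbrCount G {p, q, r} v ≤ 1 :=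
    IsTriangleSet.nbrCount_le_one hG ⟨p, q, r, h4, h5, h6, rfl⟩ hvnK.2
  rw [hu, nbrCount_union (by simp [hne, Ne.symm])] at hvK
  obtain ⟨s, hsT, hvs⟩ := nbrCount_pos.1 (show 1 ≤ nbrCount G {x, y, z} v by omega)
  obtain ⟨t, htT, hvt⟩ := nbrCount_pos.1 (show 1 ≤ nbrCount G {p, q, r} v by omega)
  simp only [Finset.mem_insert, Finset.mem_singleton] at hsT htT
  have hxy : s = x ∨ s = y := by
    rcases hsT with rfl | rfl | rfl
    exacts [Or.inl rfl, Or.inr rfl, absurd hvs.symm hz0]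
  have hqr : t = q ∨ t = r := by
    rcases htT with rfl | rfl | rfl
    exacts [absurd hvt.symm hp0, Or.inl rfl, Or.inr rfl]
  refine ⟨s, by rcases hxy with rfl | rfl <;> simp, t, by rcases hqr with rfl | rfl <;> simp,
    ?_, ?_, hvs, hvt, ?_, ?_⟩
  · rcases hxy with rfl | rfl <;> rcases hqr with rfl | rfl <;> simp [hne]
  · rcases hxy with rfl | rfl <;> rcases hqr with rfl | rfl <;> assumption
  · rcases hxy with rfl | rfl <;> omega
  · rcases hqr with rfl | rfl <;> omega

lemma exists_isIndepSet_card_eq_five (hG : ¬ HasTriangleAdjC4 G) (hd : ∀ x, 3 ≤ deg G x)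
    {u v a c : V} (hN : G.neighborFinset u = {v, a, c}) (ha : deg G a ≤ 3) (hc : deg G c ≤ 3)
    (hva : v ≠ a) (hvc : v ≠ c) (hac : a ≠ c)
    (hN0 : cut G (G.neighborFinset u) (G.neighborFinset u) = 0) {K L : Finset V}
    (hK : IsDifficultSet G (insert u (G.neighborFinset u)) K)
    (hL : IsDifficultSet G (insert u (G.neighborFinset u)) L) (hne : K ≠ L)
    (hT : IsTriangleSet G K) (hC : IsChainSet G L)
    (hcK : cut G (insert u (G.neighborFinset u)) K = 3)
    (hcL : cut G (insert u (G.neighborFinset u)) L ≤ 4) :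
    ∃ I ⊆ insert u (G.neighborFinset u) ∪ K ∪ L, IsIndepSet G I ∧ I.card = 5 := by
  have hmem : ∀ y ∈ ({v, a, c} : Finset V), y ∈ insert u (G.neighborFinset u) ∧ y ∉ K ∧ y ∉ L :=
    fun y hy => by
      have h : y ∈ insert u (G.neighborFinset u) := Finset.mem_insert_of_mem (hN ▸ hy)
      exact ⟨h, Finset.disjoint_left.1 hK.disjoint h, Finset.disjoint_left.1 hL.disjoint h⟩
  have hcut : ∀ A : Finset V, cut G A (G.neighborFinset u) =
      nbrCount G A v + (nbrCount G A a + nbrCount G A c) := fun A => by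
    rw [hN, cut_insert _ (by simp [hva, hvc]), cut_insert _ (by simpa using hac), cut_singleton]
  have hac' : ¬ G.Adj a c := fun h => by
    have := cut_pos.2 ⟨a, show a ∈ G.neighborFinset u by simp [hN], c,
      show c ∈ G.neighborFinset u by simp [hN], h⟩
    omega
  have hK1 : ∀ y ∈ ({v, a, c} : Finset V), nbrCount G K y ≤ 1 := fun y hy =>
    hT.nbrCount_le_one hG (hmem y hy).2.1
  have hKv := hK1 v (by simp)
  have hKa := hK1 a (by simp)
  have hKc := hK1 c (by simp)
  have hKN := hK.cut_insert_neighborFinset.symm.trans hcK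
  have hLN := hL.cut_insert_neighborFinset
  have hL4 := hL.le_cut_of_chain hC fun x _ => hd x
  rw [hcut] at hKN hLN
  have hL1 : ∀ y ∈ ({v, a, c} : Finset V), deg G y ≤ 3 → nbrCount G K y = 1 →
      nbrCount G L y ≤ 1 := fun y hy hy3 hyK => by
    have h₁ := nbrCount_le_deg (G := G) (insert u (G.neighborFinset u) ∪ K ∪ L) y
    have h₂ : 1 ≤ nbrCount G (insert u (G.neighborFinset u)) y :=
      nbrCount_pos.2 ⟨u, by simp, by
        rw [G.adj_comm, ← SimpleGraph.mem_neighborFinset, hN]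
        exact hy⟩
    rw [nbrCount_union (hK.union_left hL hne).disjoint, nbrCount_union hK.disjoint] at h₁
    omega
  have hLa := hL1 a (by simp) ha (by omega)
  have hLc := hL1 c (by simp) hc (by omega)
  obtain ⟨x, hx, hvx⟩ := nbrCount_pos.1 (show 1 ≤ nbrCount G K v by omega)
  have hxS := hK.nbrCount_le_one_of_triangle hd hT hcK.le hx
  obtain ⟨q, hq, r, hr, hqr, hqr', hvq, hvr, hqS, hrS⟩ :=
    hL.exists_pair_of_chain hG hd hC hcL (hmem v (by simp)).1 (by omega)
  have hnadj : ∀ y ∈ ({v, a, c} : Finset V), v ≠ y → ∀ w,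
      nbrCount G (insert u (G.neighborFinset u)) w ≤ 1 → G.Adj v w → ¬ G.Adj y w :=
    fun y hy hvy w hw hvw hyw =>
      hvy (eq_of_nbrCount_le_one hw (hmem v (by simp)).1 (hmem y hy).1 hvw.symm hyw.symm)
  have hna := hnadj a (by simp) hva
  have hnc := hnadj c (by simp) hvc
  have hax := hna x hxS hvx
  have haq := hna q hqS hvq
  have har := hna r hrS hvr
  have hcx := hnc x hxS hvx
  have hcq := hnc q hqS hvq
  have hcr := hnc r hrS hvr
  have hxq := hK.not_adj hL hne hx hq
  have hxr := hK.not_adj hL hne hx hr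
  obtain ⟨haS, haK, haL⟩ := hmem a (by simp)
  obtain ⟨hcS, hcK', hcL'⟩ := hmem c (by simp)
  have hxL := Finset.disjoint_left.1 (hK.disjoint_of_ne hL hne) hx
  refine ⟨{a, c, x, q, r}, ?_, ?_, ?_⟩
  · intro y hy
    simp only [Finset.mem_insert, Finset.mem_singleton] at hy
    rw [Finset.mem_union, Finset.mem_union]
    rcases hy with rfl | rfl | rfl | rfl | rfl
    exacts [Or.inl (Or.inl haS), Or.inl (Or.inl hcS), Or.inl (Or.inr hx), Or.inr hq, Or.inr hr]
  · clear hnadj hna hnc hmem hcut hK1 hL1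
    intro s hs t ht hst
    have hts := hst.symm
    simp only [Finset.mem_insert, Finset.mem_singleton] at hs ht
    rcases hs with rfl | rfl | rfl | rfl | rfl <;> rcases ht with rfl | rfl | rfl | rfl | rfl <;>
      first
      | exact G.irrefl hst
      | contradiction
  · have hne' : ∀ {y z : V} {A : Finset V}, z ∈ A → y ∉ A → y ≠ z := fun hz hy h => hy (h ▸ hz)
    simp [hac, hqr, hne' hx haK, hne' hx hcK', hne' hq haL, hne' hq hcL', hne' hr haL,
      hne' hr hcL', hne' hq hxL, hne' hr hxL]

/-- A triangle component of `G - N[u]` with at least three edges to `N[u]` forces `N(u)` to be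
independent. -/
lemma cut_neighborFinset_eq_zero_of_triangle (hG : ¬ HasTriangleAdjC4 G) (hd : ∀ x, 3 ≤ deg G x)
    {u : V} (hu : deg G u = 3) {K : Finset V}
    (hK : IsDifficultSet G (insert u (G.neighborFinset u)) K) (hT : IsTriangleSet G K) :
    cut G (G.neighborFinset u) (G.neighborFinset u) = 0 := by
  by_contra hN0
  obtain ⟨p, hp, q, hq, hpq⟩ := cut_pos.1 (Nat.one_le_iff_ne_zero.2 hN0)
  have hnK : ∀ y ∈ G.neighborFinset u, y ∉ K := fun y hy =>
    Finset.disjoint_left.1 hK.disjoint (Finset.mem_insert_of_mem hy)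
  have hle : ∀ y ∈ G.neighborFinset u, nbrCount G K y ≤ 1 := fun y hy =>
    hT.nbrCount_le_one hG (hnK y hy)
  have hc := hK.three_le_cut fun x _ => hd x
  rw [hK.cut_insert_neighborFinset] at hc
  have hex : ∀ y ∈ G.neighborFinset u, ∃ x ∈ K, G.Adj y x := fun y hy => by
    rw [← nbrCount_pos]
    rw [← Finset.insert_erase hy, cut_insert _ (by simp)] at hc
    have h₁ := cut_le_mul_card (G := G) (A := K) (B := (G.neighborFinset u).erase y) (m := 1)
      fun z hz => hle z (Finset.mem_of_mem_erase hz)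
    rw [Finset.card_erase_of_mem hy, ← deg_eq_card, hu] at h₁
    omega
  obtain ⟨x, hx, hpx⟩ := hex p hp
  obtain ⟨y, hy, hqy⟩ := hex q hq
  rw [SimpleGraph.mem_neighborFinset] at hp hq
  by_cases hxy : x = y
  · subst hxy
    have := eq_of_two_triangles hG hpq hp.symm hq.symm hpx hqy
    exact Finset.disjoint_left.1 hK.disjoint (by simp) (this ▸ hx)
  · refine hG ⟨p, q, u, y, x, hpq, hq.symm, hp, hqy, (hT.exists_third hx hy hxy).1.symm,
      hpx.symm, ?_, ?_⟩
    · rintro rfl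
      exact hnK p (by simpa using hp) hy
    · rintro rfl
      exact hnK q (by simpa using hq) hx

lemma IsDifficultSet.false_of_triangle_of_chain (hG : ¬ HasTriangleAdjC4 G)
    (hd : ∀ x, 3 ≤ deg G x) (h7 : NoReduction G 13 5 20) {u v a c : V}
    (hN : G.neighborFinset u = {v, a, c}) (ha : deg G a ≤ 3) (hc : deg G c ≤ 3)
    (hva : v ≠ a) (hvc : v ≠ c) (hac : a ≠ c)
    (hN0 : cut G (G.neighborFinset u) (G.neighborFinset u) = 0) {K L : Finset V}
    (hK : IsDifficultSet G (insert u (G.neighborFinset u)) K)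
    (hL : IsDifficultSet G (insert u (G.neighborFinset u)) L) (hne : K ≠ L)
    (hT : IsTriangleSet G K) (hC : IsChainSet G L)
    (hU : cut G Finset.univ (insert u (G.neighborFinset u)) ≤ 13)
    (hsum : cut G (insert u (G.neighborFinset u)) K +
      cut G (insert u (G.neighborFinset u)) L ≤ 7) : False := by
  have hu : deg G u = 3 := by
    rw [deg_eq_card, hN, Finset.card_insert_of_notMem (by simp [hva, hvc]), Finset.card_pair hac]
  have hcK := hK.le_cut_of_triangle hT fun x _ => hd x
  have hcL := hL.le_cut_of_chain hC fun x _ => hd x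
  obtain ⟨I, hIS, hI, hI5⟩ := exists_isIndepSet_card_eq_five hG hd hN ha hc hva hvc hac hN0 hK hL
    hne hT hC (by omega) (by omega)
  have hself := cut_insert_neighborFinset_self (G := G) u
  have hcard := card_insert_neighborFinset (G := G) u
  rw [hu] at hcard
  generalize insert u (G.neighborFinset u) = S at *
  have hKL := hK.union_left hL hne
  have hU' := cut_univ_union hKL
  have hself' := cut_union_self hKL
  rw [cut_univ_union hK, cut_union_left hK.disjoint, hK.cut_eq_zero hL hne, hC.cut_self,
    hT.cut_self] at hU'
  rw [cut_union_self hK, cut_union_left hK.disjoint, hK.cut_eq_zero hL hne, hC.cut_self,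
    hT.cut_self] at hself'
  have hlt := h7.lt (by rw [Finset.card_union_of_disjoint hKL.disjoint,
    Finset.card_union_of_disjoint hK.disjoint, hcard, hT.card_eq, hC.card_eq]) hI5
    ⟨hIS, hI, fun x hx y hxy => mem_of_adj_of_cut_le (by omega) (hIS hx) hxy⟩
  have ht := three_mul_card_touchingSets_add_le hd (S ∪ K ∪ L)
  omega

lemma IsDifficultSet.false_of_triangle_of_triangle (hd : ∀ x, 3 ≤ deg G x)
    (h6 : NoReduction G 10 3 16) {S I K L : Finset V} (hcard : S.card = 4) (hI : I.card = 1)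
    (hcl : IsClosedPair G S I) (hK : IsDifficultSet G S K) (hL : IsDifficultSet G S L)
    (hne : K ≠ L) (hT : IsTriangleSet G K) (hT' : IsTriangleSet G L)
    (hU : cut G Finset.univ S = 13) (hself : cut G S S = 6) : False := by
  have hcK := hK.le_cut_of_triangle hT fun x _ => hd x
  have hcL := hL.le_cut_of_triangle hT' fun x _ => hd x
  have hKL := hK.union_left hL hne
  have hU' := cut_univ_union hKL
  have hself' := cut_union_self hKL
  rw [cut_univ_union hK, cut_union_left hK.disjoint, hK.cut_eq_zero hL hne, hT'.cut_self,
    hT.cut_self] at hU'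
  rw [cut_union_self hK, cut_union_left hK.disjoint, hK.cut_eq_zero hL hne, hT'.cut_self,
    hT.cut_self] at hself'
  obtain ⟨J, hJ, hJc⟩ := hcl.exists_union_triangle hK hT
  obtain ⟨J', hJ', hJc'⟩ := hJ.exists_union_triangle hKL hT'
  have hlt := h6.lt (by rw [Finset.card_union_of_disjoint hKL.disjoint,
    Finset.card_union_of_disjoint hK.disjoint, hcard, hT.card_eq, hT'.card_eq]) (by omega) hJ'
  have ht := three_mul_card_touchingSets_add_le hd (S ∪ K ∪ L)
  omega

lemma deg_ne_four_of_adj_of_deg_eq_three (hG : ¬ HasTriangleAdjC4 G) (hd : ∀ x, 3 ≤ deg G x)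
    (h5 : NoReduction G 4 1 9) (h6 : NoReduction G 10 3 16) (h7 : NoReduction G 13 5 20)
    {u v : V} (huv : G.Adj u v) (hu : deg G u = 3) : deg G v ≠ 4 := by
  intro hv
  obtain ⟨a, c, hN, hva, hvc, hac⟩ : ∃ a c, G.neighborFinset u = {v, a, c} ∧ v ≠ a ∧ v ≠ c ∧
      a ≠ c := by
    have hvN : v ∈ G.neighborFinset u := by simpa using huv
    have hE : ((G.neighborFinset u).erase v).card = 2 := by
      rw [Finset.card_erase_of_mem hvN, ← deg_eq_card, hu]
    obtain ⟨a, c, hac, hE⟩ := Finset.card_eq_two.1 hE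
    refine ⟨a, c, by rw [← hE, Finset.insert_erase hvN], ?_, ?_, hac⟩
    · rintro rfl
      exact Finset.notMem_erase v (G.neighborFinset u) (by simp [hE])
    · rintro rfl
      exact Finset.notMem_erase v (G.neighborFinset u) (by simp [hE])
  have hU := cut_univ_insert_neighborFinset (G := G) u
  have hself := cut_insert_neighborFinset_self (G := G) u
  have hcard := card_insert_neighborFinset (G := G) u
  have hNle := cut_neighborFinset_self_le hG u
  have hNeven := even_cut_self (G := G) (G.neighborFinset u)
  have hNU : cut G Finset.univ (G.neighborFinset u) = deg G v + (deg G a + deg G c) := by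
    rw [hN, cut_insert _ (by simp [hva, hvc]), cut_insert _ (by simpa using hac), cut_singleton]
    simp only [nbrCount_univ]
  have ha := hd a
  have hc := hd c
  have hcl := isClosedPair_insert_neighborFinset (G := G) u
  rw [hNU, hu, hv] at hU
  rw [hu] at hself hcard hNle
  have hlt := h5.lt hcard (by simp) hcl
  have ht := three_mul_card_touchingSets_add_le hd (insert u (G.neighborFinset u))
  rw [Nat.even_iff] at hNeven
  obtain hN0 | hN2 : cut G (G.neighborFinset u) (G.neighborFinset u) = 0 ∨
      cut G (G.neighborFinset u) (G.neighborFinset u) = 2 := by omega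
  · have ht2 : (touchingSets G (insert u (G.neighborFinset u))).card = 2 := by omega
    obtain ⟨K, L, hne, hKL⟩ := Finset.card_eq_two.1 ht2
    have hsum := sum_touchingSets_add_le (G := G) (insert u (G.neighborFinset u))
    rw [hKL, Finset.sum_pair hne] at hsum
    obtain ⟨hK, -⟩ := mem_touchingSets.1
      (show K ∈ touchingSets G (insert u (G.neighborFinset u)) by simp [hKL])
    obtain ⟨hL, -⟩ := mem_touchingSets.1
      (show L ∈ touchingSets G (insert u (G.neighborFinset u)) by simp [hKL])
    rcases hK.1 with hKs | hKs <;> rcases hL.1 with hLs | hLs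
    · exact hK.false_of_triangle_of_triangle hd h6 hcard (by simp) hcl hL hne hKs hLs (by omega)
        (by omega)
    · exact hK.false_of_triangle_of_chain hG hd h7 hN (by omega) (by omega) hva hvc hac hN0 hL hne
        hKs hLs (by omega) (by omega)
    · exact hL.false_of_triangle_of_chain hG hd h7 hN (by omega) (by omega) hva hvc hac hN0 hK
        hne.symm hLs hKs (by omega) (by omega)
    · have := hK.le_cut_of_chain hKs fun x _ => hd x
      have := hL.le_cut_of_chain hLs fun x _ => hd x
      omega
  · have hchain : ∀ K ∈ touchingSets G (insert u (G.neighborFinset u)), IsChainSet G K :=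
      fun K hK => (mem_touchingSets.1 hK).1.1.resolve_left fun hT => by
        have := cut_neighborFinset_eq_zero_of_triangle hG hd hu (mem_touchingSets.1 hK).1 hT
        omega
    have hcut : ∀ K ∈ touchingSets G (insert u (G.neighborFinset u)),
        4 ≤ cut G (insert u (G.neighborFinset u)) K := fun K hK => by
      have := (mem_touchingSets.1 hK).1.le_cut_of_chain (hchain K hK) fun x _ => hd x
      omega
    have ht4 := mul_card_touchingSets_add_le hcut
    obtain ⟨K, hK⟩ := Finset.card_pos.1
      (show 0 < (touchingSets G (insert u (G.neighborFinset u))).card by omega)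
    have hC := hchain K hK
    have hcK := hcut K hK
    obtain ⟨hK, -⟩ := mem_touchingSets.1 hK
    obtain ⟨I, hI, hIc⟩ := hcl.exists_union_chain hK hC
    have hlt' := h6.lt (by rw [Finset.card_union_of_disjoint hK.disjoint, hcard, hC.card_eq])
      (by simpa using hIc) hI
    have ht' := three_mul_card_touchingSets_add_le hd (insert u (G.neighborFinset u) ∪ K)
    rw [cut_univ_union hK, cut_union_self hK, hC.cut_self] at hlt' ht'
    omega

end MaxDegree

/-- Claim 2.11: the maximum degree of a minimum counterexample is at most three. -/
theorem claim_max_degree_three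
(a b : ℝ) (ha : 0 < a) (hb : 0 < b)
    (h1 : 2 * a + b ≥ 1) (h2 : 3 * a + 4 * b ≥ 2) (h3 : 9 * a + 11 * b ≥ 6)
    (h4 : a + 5 * b ≥ 1) (h5 : 4 * a + 9 * b ≥ 3) (h6 : 10 * a + 16 * b ≥ 7)
    (h7 : 13 * a + 20 * b ≥ 8) (h8 : 5 * a + 14 * b ≥ 4)
    (h9 : a + (3 / 2) * b ≥ 2 / 3)
{V : Type} [Fintype V] (G : SimpleGraph V)
    (hG : ¬ HasTriangleAdjC4 G)
    (hcex : (indepNum G : ℝ) <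
      (Nat.card V : ℝ) - (a * Nat.card V + b * numEdges G + b * lambda G))
    (hmin : ∀ (W : Type) [Fintype W] (G' : SimpleGraph W),
      Nat.card W < Nat.card V → ¬ HasTriangleAdjC4 G' →
      (indepNum G' : ℝ) ≥
        (Nat.card W : ℝ) - (a * Nat.card W + b * numEdges G' + b * lambda G')) :
    ∀ v : V, deg G v ≤ 3 := by
  classical
  have red : ∀ {s k N : ℕ}, 0 < s → (s : ℝ) - k ≤ a * s + b * N → NoReduction G s k N :=
    fun hs h => noReduction hb hG hcex hmin hs h
  have hd := three_le_deg (G := G) (red (by norm_num) (by push_cast; linarith))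
    (red (by norm_num) (by push_cast; linarith)) (red (by norm_num) (by push_cast; linarith))
    (red (by norm_num) (by push_cast; linarith)) (red (by norm_num) (by push_cast; linarith))
  have hle := deg_le_four hG hd (red (by norm_num) (by push_cast; linarith))
  intro v
  by_contra! hv
  have hv4 : deg G v = 4 := by have := hle v; omega
  obtain ⟨x, y, hxy, hx, hy⟩ :=
    exists_adj_of_deg_eq_four hG (red (by norm_num) (by push_cast; linarith)) hv4
  refine deg_ne_four_of_adj_of_deg_eq_three hG hd (red (by norm_num) (by push_cast; linarith))
    (red (by norm_num) (by push_cast; linarith)) (red (by norm_num) (by push_cast; linarith))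
    hxy.symm ?_ hx
  have := hle y
  have := hd y
  omega

end Paper
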